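/- Let S ∈ St(d,p)^{⊗n} satisfy the second-order inequality Σ_{i=1}^n ⟨Λ_{ii}(S), Ẏ_i Ẏ_iᵀ⟩ ≥ Σ_{i=1}^n Σ_{j=1}^n ⟨A_{ij}, Ẏ_i Ẏ_jᵀ⟩ for every Ẏ ∈ ℝ^{nd×p} whose d×p blocks satisfy S_i Ẏ_iᵀ + Ẏ_i S_iᵀ = 0 for all i. Then (p−d)·‖ZᵀS‖_F² ≥ (p−2d)·n²d + d·‖SSᵀ‖_F² + Σ_{i=1}^n Σ_{j=1}^n (‖S_i S_jᵀ‖_F² − d)·Tr(Δ_{ij}) + (p−d)·⟨Δ, ZZᵀ − SSᵀ⟩. -/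

import Mathlib

open Matrix MeasureTheory ProbabilityTheory
open scoped BigOperators ENNReal

noncomputable section

/-- Frobenius inner product `⟨X, Y⟩ = Tr (X Yᵀ)`. -/
def finner {m k : Type*} [Fintype m] [Fintype k] (X Y : Matrix m k ℝ) : ℝ :=
  ∑ i, ∑ j, X i j * Y i j

/-- Frobenius norm. -/
def frobNorm {m k : Type*} [Fintype m] [Fintype k] (X : Matrix m k ℝ) : ℝ :=
  Real.sqrt (∑ i, ∑ j, (X i j) ^ 2)

/-- Spectral (ℓ²-operator) norm of a real matrix. -/
def opNorm {m k : Type*} [Fintype m] [Fintype k] [DecidableEq k] (X : Matrix m k ℝ) : ℝ :=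
  ‖LinearMap.toContinuousLinearMap (Matrix.toEuclideanLin X)‖

/-- The `(i,j)` d×d block of an (nd)×(nd) matrix. -/
def blk {n d : ℕ} (M : Matrix (Fin n × Fin d) (Fin n × Fin d) ℝ) (i j : Fin n) :
    Matrix (Fin d) (Fin d) ℝ := fun k l => M (i, k) (j, l)

/-- The i-th d×p block row of an (nd)×p matrix. -/
def rowBlk {n d p : ℕ} (S : Matrix (Fin n × Fin d) (Fin p) ℝ) (i : Fin n) :
    Matrix (Fin d) (Fin p) ℝ := fun k l => S (i, k) l

/-- The i-th (nd)×d block column of an (nd)×(nd) matrix. -/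
def colBlk {n d : ℕ} (M : Matrix (Fin n × Fin d) (Fin n × Fin d) ℝ) (i : Fin n) :
    Matrix (Fin n × Fin d) (Fin d) ℝ := fun q l => M q (i, l)

/-- All d×p block rows lie in the Stiefel manifold St(d,p) (for p = d: are orthogonal). -/
def StiefelBlocks {n d p : ℕ} (S : Matrix (Fin n × Fin d) (Fin p) ℝ) : Prop :=
  ∀ i, rowBlk S i * (rowBlk S i)ᵀ = 1

/-- The vertical stack Z of n copies of the identity I_d. -/
def Zmat (n d : ℕ) : Matrix (Fin n × Fin d) (Fin d) ℝ := fun q l => if q.2 = l then 1 else 0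

/-- Feasibility for the SDP relaxation: symmetric, PSD, identity diagonal blocks. -/
def sdpFeasible {n d : ℕ} (X : Matrix (Fin n × Fin d) (Fin n × Fin d) ℝ) : Prop :=
  X.IsSymm ∧ X.PosSemidef ∧ ∀ i, blk X i i = 1

/-- Global maximizer of the SDP relaxation with data `A`. -/
def sdpMaximizer {n d : ℕ} (A X : Matrix (Fin n × Fin d) (Fin n × Fin d) ℝ) : Prop :=
  sdpFeasible X ∧ ∀ Y, sdpFeasible Y → finner A Y ≤ finner A X

/-- Global maximizer of the program (P) with data `A`. -/
def progPMaximizer {n d : ℕ} (A : Matrix (Fin n × Fin d) (Fin n × Fin d) ℝ)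
    (R : Matrix (Fin n × Fin d) (Fin d) ℝ) : Prop :=
  StiefelBlocks R ∧
    ∀ R' : Matrix (Fin n × Fin d) (Fin d) ℝ, StiefelBlocks R' →
      finner A (R' * R'ᵀ) ≤ finner A (R * Rᵀ)

/-- The distance `d_F(S, Z) = min_{Q ∈ St(d,p)} ‖S − ZQ‖_F`. -/
def dF {n d p : ℕ} (S : Matrix (Fin n × Fin d) (Fin p) ℝ) : ℝ :=
  sInf {c | ∃ Q : Matrix (Fin d) (Fin p) ℝ, Q * Qᵀ = 1 ∧ c = frobNorm (S - Zmat n d * Q)}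

/-- `Λ_{ii}(S) = (1/2) Σ_j (S_i S_jᵀ A_{ji} + A_{ij} S_j S_iᵀ)`. -/
def Lam {n d p : ℕ} (A : Matrix (Fin n × Fin d) (Fin n × Fin d) ℝ)
    (S : Matrix (Fin n × Fin d) (Fin p) ℝ) (i : Fin n) : Matrix (Fin d) (Fin d) ℝ :=
  (1 / 2 : ℝ) •
    ∑ j, (rowBlk S i * (rowBlk S j)ᵀ * blk A j i + blk A i j * rowBlk S j * (rowBlk S i)ᵀ)

/-- Block diagonal matrix with given d×d diagonal blocks. -/
def blkDiag {n d : ℕ} (D : Fin n → Matrix (Fin d) (Fin d) ℝ) :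
    Matrix (Fin n × Fin d) (Fin n × Fin d) ℝ :=
  fun q r => if q.1 = r.1 then D q.1 q.2 r.2 else 0

/-- Local maximizer of `f(S) = ⟨A, S Sᵀ⟩` over `St(d,p)^{⊗n}`. -/
def isLocalMax {n d p : ℕ} (A : Matrix (Fin n × Fin d) (Fin n × Fin d) ℝ)
    (S : Matrix (Fin n × Fin d) (Fin p) ℝ) : Prop :=
  StiefelBlocks S ∧ ∃ ε > (0 : ℝ), ∀ S' : Matrix (Fin n × Fin d) (Fin p) ℝ,
    StiefelBlocks S' → frobNorm (S' - S) < ε → finner A (S' * S'ᵀ) ≤ finner A (S * Sᵀ)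

/-- First-order criticality: `Σ_j A_{ij} S_j = Λ_{ii}(S) S_i` for all i. -/
def firstOrderCrit {n d p : ℕ} (A : Matrix (Fin n × Fin d) (Fin n × Fin d) ℝ)
    (S : Matrix (Fin n × Fin d) (Fin p) ℝ) : Prop :=
  ∀ i, (∑ j, blk A i j * rowBlk S j) = Lam A S i * rowBlk S i

/-- Second-order necessary inequality over tangent directions. -/
def secondOrderIneq {n d p : ℕ} (A : Matrix (Fin n × Fin d) (Fin n × Fin d) ℝ)
    (S : Matrix (Fin n × Fin d) (Fin p) ℝ) : Prop :=
  ∀ Y : Matrix (Fin n × Fin d) (Fin p) ℝ,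
    (∀ i, rowBlk S i * (rowBlk Y i)ᵀ + rowBlk Y i * (rowBlk S i)ᵀ = 0) →
    ∑ i, ∑ j, finner (blk A i j) (rowBlk Y i * (rowBlk Y j)ᵀ) ≤
      ∑ i, finner (Lam A S i) (rowBlk Y i * (rowBlk Y i)ᵀ)

/-- Second-order critical point of `f`. -/
def secondOrderCrit {n d p : ℕ} (A : Matrix (Fin n × Fin d) (Fin n × Fin d) ℝ)
    (S : Matrix (Fin n × Fin d) (Fin p) ℝ) : Prop :=
  StiefelBlocks S ∧ firstOrderCrit A S ∧ secondOrderIneq A S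

/-- Partial trace `Tr_d(Δ) ∈ ℝ^{n×n}`. -/
def partialTrace {n d : ℕ} (Δ : Matrix (Fin n × Fin d) (Fin n × Fin d) ℝ) :
    Matrix (Fin n) (Fin n) ℝ := fun i j => (blk Δ i j).trace

/-- Singular values of a d×p real matrix (square roots of the eigenvalues of `M Mᴴ`). -/
def singVals {d p : ℕ} (M : Matrix (Fin d) (Fin p) ℝ) (i : Fin d) : ℝ :=
  Real.sqrt ((Matrix.isHermitian_mul_conjTranspose_self M).eigenvalues i)

/-- Nuclear norm: sum of singular values. -/
def nuclearNorm {d p : ℕ} (M : Matrix (Fin d) (Fin p) ℝ) : ℝ :=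
  ∑ i, singVals M i

/-- The law of the iid standard Gaussian coordinates indexing the noise. -/
def gaussianEnsemble (n d : ℕ) :
    Measure (((Fin n × Fin d) × (Fin n × Fin d)) → ℝ) :=
  Measure.pi fun _ => gaussianReal 0 1

/-- The symmetric Gaussian random matrix `W` built from the iid coordinates:
`W_{ii} = 0`, the entries of `W_{ij}` for `i < j` are iid standard Gaussians, and
`W_{ji} = W_{ij}ᵀ`. -/
def Wof {n d : ℕ} (ω : ((Fin n × Fin d) × (Fin n × Fin d)) → ℝ) :
    Matrix (Fin n × Fin d) (Fin n × Fin d) ℝ :=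
  fun q r => if q.1 < r.1 then ω (q, r) else if r.1 < q.1 then ω (r, q) else 0

theorem finner_eq_trace {m k : Type*} [Fintype m] [Fintype k] (X Y : Matrix m k ℝ) :
    finner X Y = (X * Yᵀ).trace := by
  simp [finner, Matrix.trace, Matrix.mul_apply]

theorem frobNorm_sq {m k : Type*} [Fintype m] [Fintype k] (X : Matrix m k ℝ) :
    frobNorm X ^ 2 = finner X X := by
  rw [frobNorm, Real.sq_sqrt (by positivity)]
  simp [finner, sq]

/-- The Frobenius inner product of block matrices is the sum over blocks. -/
theorem finner_eq_sum_blk {n d : ℕ} (M N : Matrix (Fin n × Fin d) (Fin n × Fin d) ℝ) :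
    finner M N = ∑ i, ∑ j, finner (blk M i j) (blk N i j) := by
  simp only [finner, blk, Fintype.sum_prod_type]
  exact Finset.sum_congr rfl fun i _ => Finset.sum_comm

theorem blk_mul_transpose {n d p : ℕ} (S T : Matrix (Fin n × Fin d) (Fin p) ℝ) (i j : Fin n) :
    blk (S * Tᵀ) i j = rowBlk S i * (rowBlk T j)ᵀ := by
  ext k l
  simp [blk, rowBlk, Matrix.mul_apply]

theorem blk_Zmat_mul_transpose {n d : ℕ} (i j : Fin n) :
    blk (Zmat n d * (Zmat n d)ᵀ) i j = 1 := by
  have h (i : Fin n) : rowBlk (Zmat n d) i = 1 := by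
    ext k l
    simp [rowBlk, Zmat, Matrix.one_apply]
  rw [blk_mul_transpose, h, h, Matrix.transpose_one, Matrix.one_mul]

theorem blk_add {n d : ℕ} (M N : Matrix (Fin n × Fin d) (Fin n × Fin d) ℝ) (i j : Fin n) :
    blk (M + N) i j = blk M i j + blk N i j := rfl

theorem finner_add_left {m k : Type*} [Fintype m] [Fintype k] (X Y W : Matrix m k ℝ) :
    finner (X + Y) W = finner X W + finner Y W := by
  simp only [finner_eq_trace, Matrix.add_mul, Matrix.trace_add]

theorem finner_sub_right {m k : Type*} [Fintype m] [Fintype k] (X Y W : Matrix m k ℝ) :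
    finner X (Y - W) = finner X Y - finner X W := by
  simp only [finner_eq_trace, Matrix.transpose_sub, Matrix.mul_sub, Matrix.trace_sub]

/-- `‖ZᵀS‖_F² = ⟨ZZᵀ, SSᵀ⟩`. -/
theorem frobNorm_transpose_mul_sq {m k l : Type*} [Fintype m] [Fintype k] [Fintype l]
    (Z : Matrix m k ℝ) (S : Matrix m l ℝ) :
    frobNorm (Zᵀ * S) ^ 2 = finner (Z * Zᵀ) (S * Sᵀ) := by
  rw [frobNorm_sq, finner_eq_trace, finner_eq_trace]
  simp only [Matrix.transpose_mul, Matrix.transpose_transpose]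
  rw [Matrix.mul_assoc Z, Matrix.trace_mul_comm Z]
  simp only [Matrix.mul_assoc]

/-- `Σ_i Tr Λ_{ii}(S) = ⟨A, SSᵀ⟩`. -/
theorem sum_trace_Lam {n d p : ℕ} (A : Matrix (Fin n × Fin d) (Fin n × Fin d) ℝ)
    (S : Matrix (Fin n × Fin d) (Fin p) ℝ) :
    ∑ i, (Lam A S i).trace = finner A (S * Sᵀ) := by
  have h1 (i j : Fin n) : (rowBlk S i * (rowBlk S j)ᵀ * blk A j i).trace =
      finner (blk A j i) (blk (S * Sᵀ) j i) := by
    rw [blk_mul_transpose, finner_eq_trace, Matrix.trace_mul_comm, Matrix.transpose_mul,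
      Matrix.transpose_transpose]
  have h2 (i j : Fin n) : (blk A i j * rowBlk S j * (rowBlk S i)ᵀ).trace =
      finner (blk A i j) (blk (S * Sᵀ) i j) := by
    rw [blk_mul_transpose, finner_eq_trace, Matrix.transpose_mul,
      Matrix.transpose_transpose, Matrix.mul_assoc]
  simp only [Lam, Matrix.trace_smul, Matrix.trace_sum, Matrix.trace_add, h1, h2,
    Finset.sum_add_distrib, smul_eq_mul, ← Finset.mul_sum]
  rw [Finset.sum_comm, ← finner_eq_sum_blk]
  ring

/-- The stacked `d × p` blocks `E_{ab} Q_i`, for matrices `Q_i` and the matrix unit `E_{ab}`. -/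
def unitMulStack {n d p : ℕ} (Q : Fin n → Matrix (Fin p) (Fin p) ℝ) (a : Fin d) (b : Fin p) :
    Matrix (Fin n × Fin d) (Fin p) ℝ :=
  fun q => (Matrix.single a b (1 : ℝ) * Q q.1) q.2

theorem rowBlk_unitMulStack {n d p : ℕ} (Q : Fin n → Matrix (Fin p) (Fin p) ℝ) (a : Fin d)
    (b : Fin p) (i : Fin n) :
    rowBlk (unitMulStack Q a b) i = Matrix.single a b (1 : ℝ) * Q i := rfl

/-- Summing `⟨B, E_{ab} U (E_{ab} V)ᵀ⟩` over all matrix units `E_{ab}` gives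
`Tr B · Tr (U Vᵀ)`. -/
theorem sum_finner_single_mul {d p : ℕ} (B : Matrix (Fin d) (Fin d) ℝ)
    (U V : Matrix (Fin p) (Fin p) ℝ) :
    ∑ a : Fin d, ∑ b : Fin p,
      finner B (Matrix.single a b (1 : ℝ) * U * (Matrix.single a b (1 : ℝ) * V)ᵀ) =
      B.trace * (U * Vᵀ).trace := by
  have h (a : Fin d) (b : Fin p) :
      finner B (Matrix.single a b (1 : ℝ) * U * (Matrix.single a b (1 : ℝ) * V)ᵀ) =
      B a a * (U * Vᵀ) b b := by
    have h' : Matrix.single a b (1 : ℝ) * U * (Matrix.single a b (1 : ℝ) * V)ᵀ =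
        Matrix.single a a ((U * Vᵀ) b b) := by
      rw [Matrix.transpose_mul, Matrix.transpose_single, Matrix.mul_assoc,
        ← Matrix.mul_assoc U, ← Matrix.mul_assoc, Matrix.single_mul_mul_single]
      simp
    rw [h', finner_eq_trace, Matrix.transpose_single, Matrix.trace_mul_single]
    simp
  simp only [h, Matrix.trace, Matrix.diag, Finset.sum_mul_sum]

/-- For `S, T ∈ St(d,p)`, `Tr ((I - SᵀS)(I - TᵀT)ᵀ) = p - 2d + ‖STᵀ‖_F²`. -/
theorem trace_one_sub_mul_one_sub {d p : ℕ} {S T : Matrix (Fin d) (Fin p) ℝ}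
    (hS : S * Sᵀ = 1) (hT : T * Tᵀ = 1) :
    ((1 - Sᵀ * S) * (1 - Tᵀ * T)ᵀ).trace = (p : ℝ) - 2 * d + frobNorm (S * Tᵀ) ^ 2 := by
  have h1 : (Sᵀ * S).trace = d := by rw [Matrix.trace_mul_comm, hS]; simp
  have h2 : (Tᵀ * T).trace = d := by rw [Matrix.trace_mul_comm, hT]; simp
  have h3 : (Sᵀ * S * (Tᵀ * T)).trace = frobNorm (S * Tᵀ) ^ 2 := by
    rw [frobNorm_sq, finner_eq_trace, Matrix.transpose_mul, Matrix.transpose_transpose,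
      Matrix.mul_assoc, Matrix.trace_mul_comm]
    simp only [Matrix.mul_assoc]
  have h4 : (1 - Sᵀ * S) * (1 - Tᵀ * T)ᵀ = 1 - Tᵀ * T - Sᵀ * S + Sᵀ * S * (Tᵀ * T) := by
    rw [Matrix.transpose_sub, Matrix.transpose_one, Matrix.transpose_mul,
      Matrix.transpose_transpose]
    noncomm_ring
  rw [h4, Matrix.trace_add, Matrix.trace_sub, Matrix.trace_sub, h1, h2, h3, Matrix.trace_one,
    Fintype.card_fin]
  ring

/-- The second-order inequality summed over the tangent directions `E_{ab} (I - S_iᵀ S_i)`. -/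
theorem secondOrderIneq.sum_le {n d p : ℕ} {A : Matrix (Fin n × Fin d) (Fin n × Fin d) ℝ}
    {S : Matrix (Fin n × Fin d) (Fin p) ℝ} (hS : StiefelBlocks S) (h2 : secondOrderIneq A S) :
    ∑ i, ∑ j, (blk A i j).trace *
        ((p : ℝ) - 2 * d + frobNorm (rowBlk S i * (rowBlk S j)ᵀ) ^ 2) ≤
      ((p : ℝ) - d) * finner A (S * Sᵀ) := by
  set Q : Fin n → Matrix (Fin p) (Fin p) ℝ := fun i => 1 - (rowBlk S i)ᵀ * rowBlk S i with hQ
  have htan (a : Fin d) (b : Fin p) (i : Fin n) :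
      rowBlk S i * (rowBlk (unitMulStack Q a b) i)ᵀ +
        rowBlk (unitMulStack Q a b) i * (rowBlk S i)ᵀ = 0 := by
    have h : Q i * (rowBlk S i)ᵀ = 0 := by
      rw [hQ, Matrix.sub_mul, Matrix.mul_assoc, hS i, Matrix.one_mul, Matrix.mul_one, sub_self]
    have h' : rowBlk (unitMulStack Q a b) i * (rowBlk S i)ᵀ = 0 := by
      rw [rowBlk_unitMulStack, Matrix.mul_assoc, h, Matrix.mul_zero]
    rw [h', add_zero, ← Matrix.transpose_transpose (rowBlk S i), ← Matrix.transpose_mul, h',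
      Matrix.transpose_zero]
  have key := Finset.sum_le_sum fun a (_ : a ∈ Finset.univ) =>
    Finset.sum_le_sum fun b (_ : b ∈ Finset.univ) => h2 (unitMulStack Q a b) (htan a b)
  have hswap (f : Fin d → Fin p → Fin n → ℝ) :
      ∑ a, ∑ b, ∑ i, f a b i = ∑ i, ∑ a, ∑ b, f a b i := by
    rw [Finset.sum_comm (γ := Fin n)]
    exact Finset.sum_congr rfl fun a _ => Finset.sum_comm
  simp only [hswap, rowBlk_unitMulStack, sum_finner_single_mul] at key
  simp only [hQ, trace_one_sub_mul_one_sub (hS _) (hS _)] at key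
  refine key.trans (le_of_eq ?_)
  rw [← sum_trace_Lam, Finset.mul_sum]
  refine Finset.sum_congr rfl fun i _ => ?_
  rw [hS i, frobNorm_sq, finner_eq_trace]
  simp
  ring

/-- consequence of the second-order necessary condition (Lemma 5.10). -/
theorem second_order_inequality {n d p : ℕ} (hn : 2 ≤ n) (hd : 1 ≤ d) (hp : d ≤ p)
    (Δ : Matrix (Fin n × Fin d) (Fin n × Fin d) ℝ)
    (hΔsym : Δ.IsSymm) (hΔdiag : ∀ i, blk Δ i i = 0)
    (A : Matrix (Fin n × Fin d) (Fin n × Fin d) ℝ)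
    (hA : A = Zmat n d * (Zmat n d)ᵀ + Δ)
    (S : Matrix (Fin n × Fin d) (Fin p) ℝ) (hS : StiefelBlocks S)
    (h2 : secondOrderIneq A S) :
    ((p : ℝ) - d) * frobNorm ((Zmat n d)ᵀ * S) ^ 2 ≥
      ((p : ℝ) - 2 * d) * (n : ℝ) ^ 2 * d
      + (d : ℝ) * frobNorm (S * Sᵀ) ^ 2
      + ∑ i : Fin n, ∑ j : Fin n,
          (frobNorm (rowBlk S i * (rowBlk S j)ᵀ) ^ 2 - (d : ℝ)) * (blk Δ i j).trace
      + ((p : ℝ) - d) * finner Δ (Zmat n d * (Zmat n d)ᵀ - S * Sᵀ) := by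
  have key := h2.sum_le hS
  have hA' (i j : Fin n) : (blk A i j).trace = d + (blk Δ i j).trace := by
    rw [hA, blk_add, blk_Zmat_mul_transpose, Matrix.trace_add, Matrix.trace_one, Fintype.card_fin]
  have hSS : frobNorm (S * Sᵀ) ^ 2 =
      ∑ i, ∑ j, frobNorm (rowBlk S i * (rowBlk S j)ᵀ) ^ 2 := by
    simp only [frobNorm_sq, finner_eq_sum_blk (S * Sᵀ), blk_mul_transpose]
  have hΔZ : finner Δ (Zmat n d * (Zmat n d)ᵀ) = ∑ i, ∑ j, (blk Δ i j).trace := by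
    simp only [finner_eq_sum_blk Δ, blk_Zmat_mul_transpose, finner_eq_trace,
      Matrix.transpose_one, Matrix.mul_one]
  have hsum : ∑ i, ∑ j, (blk A i j).trace *
        ((p : ℝ) - 2 * d + frobNorm (rowBlk S i * (rowBlk S j)ᵀ) ^ 2) =
      ((p : ℝ) - 2 * d) * (n : ℝ) ^ 2 * d + (d : ℝ) * frobNorm (S * Sᵀ) ^ 2
      + ∑ i : Fin n, ∑ j : Fin n,
          (frobNorm (rowBlk S i * (rowBlk S j)ᵀ) ^ 2 - (d : ℝ)) * (blk Δ i j).trace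
      + ((p : ℝ) - d) * ∑ i, ∑ j, (blk Δ i j).trace := by
    have hconst : ((p : ℝ) - 2 * d) * (n : ℝ) ^ 2 * d =
        ∑ _i : Fin n, ∑ _j : Fin n, ((p : ℝ) - 2 * d) * d := by
      simp
      ring
    rw [hSS, hconst]
    simp only [Finset.mul_sum, ← Finset.sum_add_distrib]
    refine Finset.sum_congr rfl fun i _ => Finset.sum_congr rfl fun j _ => ?_
    rw [hA']
    ring
  rw [hsum, ← hΔZ, hA, finner_add_left, ← frobNorm_transpose_mul_sq] at key
  rw [finner_sub_right]
  linarith
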